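/- Let X be a Banach space and F : A(𝕋) → X a bounded linear map with ‖F‖ ≤ 1. Suppose 0 ≤ α ≤ 1 is such that for all φ, ψ ∈ A(𝕋) with supp φ ∩ supp ψ = ∅ one has ‖F(φ ∗ ψ̌)‖ ≤ α‖φ‖_{A(𝕋)}‖ψ‖_{A(𝕋)}. Then for the function f ∈ A(𝕋) given by f(s) = e^{is} − 1, one has ‖F(f)‖ ≤ 12·√(π(1+√2))·√α. -/

import Mathlib

open MeasureTheory AddCircle

noncomputable section

local instance : Fact (0 < 2 * Real.pi) := ⟨by positivity⟩

/-- The circle `𝕋 = ℝ/2πℤ`. -/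
abbrev Circle2Pi : Type := AddCircle (2 * Real.pi)

/-- Membership in the Fourier algebra `A(𝕋)`: continuity together with absolute
summability of the Fourier coefficients. -/
def MemFourierAlg (f : Circle2Pi → ℂ) : Prop :=
  Continuous f ∧ Summable fun n : ℤ => ‖fourierCoeff f n‖

/-- The norm of the Fourier algebra `A(𝕋)`: `‖f‖ = ∑ₙ |f̂(n)|`. -/
def fourierAlgNorm (f : Circle2Pi → ℂ) : ℝ :=
  ∑' n : ℤ, ‖fourierCoeff f n‖

/-- Normalized convolution on `𝕋` (with respect to the probability Haar measure). -/
def circleConv (f g : Circle2Pi → ℂ) : Circle2Pi → ℂ :=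
  fun x => ∫ y : Circle2Pi, f y * g (x - y) ∂haarAddCircle

/-- bounded measurable -/
def Nice (u : Circle2Pi → ℂ) : Prop := Measurable u ∧ ∃ C : ℝ, ∀ x, ‖u x‖ ≤ C

/-- the measure -/
abbrev hm : Measure Circle2Pi := haarAddCircle

lemma Nice.mul {u v : Circle2Pi → ℂ} (hu : Nice u) (hv : Nice v) : Nice (fun x => u x * v x) := by
  obtain ⟨h1, C, hC⟩ := hu
  obtain ⟨h2, D, hD⟩ := hv
  refine ⟨h1.mul h2, C * D, fun x => ?_⟩
  rw [norm_mul]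
  exact mul_le_mul (hC x) (hD x) (norm_nonneg _) ((norm_nonneg _).trans (hC x))

lemma nice_of_cont {u : Circle2Pi → ℂ} (hu : Continuous u) : Nice u := by
  refine ⟨hu.measurable, ?_⟩
  obtain ⟨C, hC⟩ := isCompact_univ.exists_bound_of_continuousOn hu.continuousOn
  exact ⟨C, fun x => hC x (Set.mem_univ _)⟩

lemma Nice.integrable {u : Circle2Pi → ℂ} (hu : Nice u) : Integrable u hm := by
  obtain ⟨h1, C, hC⟩ := hu
  exact Integrable.of_bound h1.aestronglyMeasurable C (Filter.Eventually.of_forall hC)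

lemma Nice.memLp {u : Circle2Pi → ℂ} (hu : Nice u) (p : ENNReal) : MemLp u p hm := by
  obtain ⟨h1, C, hC⟩ := hu
  exact MemLp.of_bound h1.aestronglyMeasurable C (Filter.Eventually.of_forall hC)

lemma Nice.comp_sub {u v : Circle2Pi → ℂ} (hu : Nice u) (hv : Nice v) (x : Circle2Pi) :
    Nice (fun y => u y * v (x - y)) := by
  refine Nice.mul hu ⟨hv.1.comp (measurable_const.sub measurable_id), ?_⟩
  obtain ⟨h1, C, hC⟩ := hv
  exact ⟨C, fun y => hC _⟩

lemma fourier_mul_sub (n : ℤ) (x y : Circle2Pi) :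
    (fourier n y : ℂ) * fourier n (x - y) = fourier n x := by
  rw [fourier_apply, fourier_apply, fourier_apply, ← Circle.coe_mul, ← AddCircle.toCircle_add,
    ← smul_add, add_sub_cancel]

lemma conv_mod (n : ℤ) (u v : Circle2Pi → ℂ) (x : Circle2Pi) :
    circleConv (fun y => fourier n y * u y) (fun y => fourier n y * v y) x
      = fourier n x * circleConv u v x := by
  unfold circleConv
  rw [← integral_const_mul]
  congr 1
  ext y
  rw [← fourier_mul_sub n x y]
  ring

lemma integral_conv {u v : Circle2Pi → ℂ} (hu : Nice u) (hv : Nice v) :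
    ∫ x, circleConv u v x ∂hm = (∫ x, u x ∂hm) * ∫ x, v x ∂hm := by
  have := integral_convolution (μ := hm) (ν := hm) (ContinuousLinearMap.mul ℝ ℂ)
    hu.integrable hv.integrable
  simpa [convolution, circleConv] using this

lemma coeff_conv {u v : Circle2Pi → ℂ} (hu : Nice u) (hv : Nice v) (n : ℤ) :
    fourierCoeff (circleConv u v) n = fourierCoeff u n * fourierCoeff v n := by
  unfold fourierCoeff
  simp only [smul_eq_mul]
  have h := integral_conv ((nice_of_cont (fourier (-n)).continuous).mul hu)
    ((nice_of_cont (fourier (-n)).continuous).mul hv)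
  rw [← h]
  congr 1
  ext x
  rw [conv_mod]

lemma conv_cont {u v : Circle2Pi → ℂ} (hu : Nice u) (hv : Nice v)
    (hc : ∀ᵐ z ∂hm, ContinuousAt v z) : Continuous (circleConv u v) := by
  rw [continuous_iff_continuousAt]
  intro x
  obtain ⟨-, C, hC⟩ := hu.comp_sub hv x
  obtain ⟨hvm, D, hD⟩ := hv
  refine continuousAt_of_dominated (bound := fun y => ‖u y‖ * D) ?_ ?_ ?_ ?_
  · exact Filter.Eventually.of_forall fun x' =>
      (hu.comp_sub ⟨hvm, D, hD⟩ x').1.aestronglyMeasurable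
  · refine Filter.Eventually.of_forall fun x' => Filter.Eventually.of_forall fun y => ?_
    rw [norm_mul]
    exact mul_le_mul_of_nonneg_left (hD _) (norm_nonneg _)
  · exact hu.integrable.norm.mul_const _
  · have hq := (quasiMeasurePreserving_sub_left_of_right_invariant hm x).ae hc
    filter_upwards [hq] with y hy
    refine continuousAt_const.mul ?_
    exact ContinuousAt.comp (f := fun x' => x' - y) (g := v) hy (by fun_prop)

/-- A norm bound -/
def AB (u : Circle2Pi → ℂ) (K : ℝ) : Prop :=
  (Summable fun n : ℤ => ‖fourierCoeff u n‖) ∧ ∑' n : ℤ, ‖fourierCoeff u n‖ ≤ K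

lemma AB.of_le {u : Circle2Pi → ℂ} {g : ℤ → ℝ} {K : ℝ} (hg : Summable g)
    (hK : ∑' n, g n ≤ K) (h : ∀ n, ‖fourierCoeff u n‖ ≤ g n) : AB u K := by
  have hs : Summable fun n : ℤ => ‖fourierCoeff u n‖ :=
    Summable.of_nonneg_of_le (fun _ => norm_nonneg _) h hg
  exact ⟨hs, (hs.tsum_le_tsum h hg).trans hK⟩

lemma AB.mono {u : Circle2Pi → ℂ} {K L : ℝ} (h : AB u K) (hK : K ≤ L) : AB u L :=
  ⟨h.1, h.2.trans hK⟩

lemma AB.add {u v : Circle2Pi → ℂ} {K L : ℝ} (h : AB u K) (h' : AB v L)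
    (hu : Integrable u hm) (hv : Integrable v hm) : AB (fun x => u x + v x) (K + L) := by
  refine AB.of_le (h.1.add h'.1) ?_ fun n => ?_
  · rw [h.1.tsum_add h'.1]; exact add_le_add h.2 h'.2
  · have : fourierCoeff (fun x => u x + v x) n = fourierCoeff u n + fourierCoeff v n :=
      congrFun (fourierCoeff.add hu hv) n
    rw [this]; exact norm_add_le _ _

lemma AB.smul {u : Circle2Pi → ℂ} {K : ℝ} (h : AB u K) (c : ℂ) :
    AB (fun x => c * u x) (‖c‖ * K) := by
  refine AB.of_le (h.1.mul_left ‖c‖) ?_ fun n => ?_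
  · rw [tsum_mul_left]; exact mul_le_mul_of_nonneg_left h.2 (norm_nonneg _)
  · rw [fourierCoeff.const_mul, norm_mul]

lemma AB.conv_left {u v : Circle2Pi → ℂ} {K M : ℝ} (h : AB v K) (hu : Nice u) (hv : Nice v)
    (hM : 0 ≤ M) (hb : ∫ x, ‖u x‖ ∂hm ≤ M) : AB (circleConv u v) (M * K) := by
  refine AB.of_le (h.1.mul_left M) ?_ fun n => ?_
  · rw [tsum_mul_left]; exact mul_le_mul_of_nonneg_left h.2 hM
  · rw [coeff_conv hu hv, norm_mul]
    refine mul_le_mul_of_nonneg_right ?_ (norm_nonneg _)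
    refine le_trans ?_ hb
    unfold fourierCoeff
    refine (norm_integral_le_integral_norm _).trans (le_of_eq ?_)
    congr 1
    ext x
    rw [norm_smul, fourier_apply, Circle.norm_coe, one_mul]

lemma parseval {u : Circle2Pi → ℂ} (hu : Nice u) :
    HasSum (fun n => ‖fourierCoeff u n‖ ^ 2) (∫ x, ‖u x‖ ^ 2 ∂hm) := by
  have h := hu.memLp 2
  have := hasSum_sq_fourierCoeff h.toLp
  rw [fourierCoeff_congr_ae h.coeFn_toLp] at this
  convert this using 1
  refine integral_congr_ae ?_
  filter_upwards [h.coeFn_toLp] with x hx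
  rw [hx]

lemma AB.conv {u v : Circle2Pi → ℂ} {P Q : ℝ} (hu : Nice u) (hv : Nice v)
    (hP : ∫ x, ‖u x‖ ^ 2 ∂hm ≤ P) (hQ : ∫ x, ‖v x‖ ^ 2 ∂hm ≤ Q) :
    AB (circleConv u v) (√P * √Q) := by
  have h := Real.summable_and_inner_le_Lp_mul_Lq_tsum_of_nonneg (p := 2) (q := 2)
    (f := fun n => ‖fourierCoeff u n‖) (g := fun n => ‖fourierCoeff v n‖)
    (by constructor <;> norm_num) (fun _ => norm_nonneg _) (fun _ => norm_nonneg _)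
    (by simpa using (parseval hu).summable) (by simpa using (parseval hv).summable)
  refine AB.of_le h.1 (h.2.trans ?_) fun n => ?_
  · rw [← Real.sqrt_eq_rpow, ← Real.sqrt_eq_rpow]
    simp only [Real.rpow_two]
    rw [(parseval hu).tsum_eq, (parseval hv).tsum_eq]
    gcongr
  · rw [coeff_conv hu hv, norm_mul]

/-- indicator of a ball -/
def ind (r : ℝ) : Circle2Pi → ℂ := (Metric.closedBall 0 r).indicator 1

/-- the function `e^{is} - 1` -/
def E1 : Circle2Pi → ℂ := fun x => fourier 1 x - 1

lemma E1_cont : Continuous E1 := (fourier 1).continuous.sub continuous_const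

lemma norm_fourier (n : ℤ) (x : Circle2Pi) : ‖(fourier n x : ℂ)‖ = 1 := by
  rw [fourier_apply, Circle.norm_coe]

lemma E1_bound (x : Circle2Pi) : ‖E1 x‖ ≤ ‖x‖ := by
  obtain ⟨t, ht⟩ : ∃ t : ℝ, (t : Circle2Pi) = x := QuotientAddGroup.mk_surjective x
  have key : ∀ t : ℝ, ‖E1 (t : Circle2Pi)‖ ≤ |t| := by
    intro t
    have h := Real.norm_exp_I_mul_ofReal_sub_one_le (x := t)
    rw [Real.norm_eq_abs] at h
    convert h using 2
    unfold E1
    rw [fourier_coe_apply]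
    congr 2
    have : (Real.pi : ℂ) ≠ 0 := by exact_mod_cast Real.pi_ne_zero
    push_cast
    field_simp
  subst ht
  set k : ℤ := round ((2 * Real.pi)⁻¹ * t)
  have h2 : ((t - k * (2 * Real.pi) : ℝ) : Circle2Pi) = (t : Circle2Pi) := by
    have : ((k * (2 * Real.pi) : ℝ) : Circle2Pi) = 0 := by
      rw [AddCircle.coe_eq_zero_iff]
      exact ⟨k, by simp⟩
    rw [AddCircle.coe_sub, this, sub_zero]
  rw [AddCircle.norm_eq, ← h2]
  exact key _

lemma nice_ind (r : ℝ) : Nice (ind r) := by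
  refine ⟨measurable_one.indicator Metric.isClosed_closedBall.measurableSet, 1, fun x => ?_⟩
  unfold ind
  refine (norm_indicator_le_norm_self _ _).trans ?_
  simp

lemma ind_of_le {r : ℝ} {x : Circle2Pi} (h : ‖x‖ ≤ r) : ind r x = 1 := by
  unfold ind
  rw [Set.indicator_of_mem (by simpa using h)]; rfl

lemma ind_of_gt {r : ℝ} {x : Circle2Pi} (h : r < ‖x‖) : ind r x = 0 := by
  unfold ind
  rw [Set.indicator_of_notMem (by simpa using h)]

lemma ind_neg (r : ℝ) (x : Circle2Pi) : ind r (-x) = ind r x := by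
  rcases le_or_gt ‖x‖ r with h | h
  · rw [ind_of_le h, ind_of_le (by rwa [norm_neg])]
  · rw [ind_of_gt h, ind_of_gt (by rwa [norm_neg])]

lemma ae_haar {p : Circle2Pi → Prop} (h : ∀ᵐ x, p x) : ∀ᵐ x ∂hm, p x := by
  rw [volume_eq_smul_haarAddCircle] at h
  have h0 : ENNReal.ofReal (2 * Real.pi) ≠ 0 := by
    simp [Real.pi_pos]
  rw [ae_iff] at h ⊢
  rw [Measure.smul_apply, smul_eq_mul, mul_eq_zero] at h
  exact h.resolve_left h0

lemma ind_ae_cont (r : ℝ) : ∀ᵐ z ∂hm, ContinuousAt (ind r) z := by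
  apply ae_haar
  have h := AddCircle.closedBall_ae_eq_ball (T := 2 * Real.pi) (x := 0) (ε := r)
  filter_upwards [h] with z hz
  by_cases hz' : z ∈ Metric.ball (0 : Circle2Pi) r
  · have : ind r =ᶠ[nhds z] fun _ => 1 := by
      filter_upwards [Metric.isOpen_ball.mem_nhds hz'] with y hy
      exact ind_of_le (by simpa using (Metric.mem_ball.1 hy).le)
    exact continuousAt_const.congr this.symm
  · have hz2 : z ∉ Metric.closedBall (0 : Circle2Pi) r := fun h' => hz' (hz.mp h')
    have : ind r =ᶠ[nhds z] fun _ => 0 := by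
      filter_upwards [Metric.isClosed_closedBall.isOpen_compl.mem_nhds hz2] with y hy
      exact ind_of_gt (by simpa using hy)
    exact continuousAt_const.congr this.symm

lemma meas_ball {r : ℝ} (h0 : 0 ≤ r) (h1 : r ≤ Real.pi) :
    hm.real (Metric.closedBall 0 r) = r / Real.pi := by
  have h := AddCircle.volume_closedBall (T := 2 * Real.pi) (x := 0) r
  rw [volume_eq_smul_haarAddCircle, Measure.smul_apply, smul_eq_mul,
    min_eq_right (by linarith)] at h
  have h2 := congrArg ENNReal.toReal h
  rw [ENNReal.toReal_mul, ENNReal.toReal_ofReal (by positivity),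
    ENNReal.toReal_ofReal (by positivity)] at h2
  rw [Measure.real]
  have := Real.pi_pos
  field_simp
  linarith

lemma int_ind {r : ℝ} (h0 : 0 ≤ r) (h1 : r ≤ Real.pi) :
    ∫ x, ind r x ∂hm = ((r / Real.pi : ℝ) : ℂ) := by
  unfold ind
  have := integral_indicator_const (μ := hm) (1 : ℂ)
    (Metric.isClosed_closedBall (x := (0 : Circle2Pi)) (ε := r)).measurableSet
  rw [meas_ball h0 h1] at this
  refine this.trans ?_
  simp

lemma int_norm_ind {r : ℝ} (h0 : 0 ≤ r) (h1 : r ≤ Real.pi) {u : Circle2Pi → ℂ} {c : ℝ}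
    (hu : ∀ x, ‖x‖ ≤ r → ‖u x‖ ≤ c) (hum : Nice u) :
    ∫ x, ‖u x * ind r x‖ ^ 2 ∂hm ≤ c ^ 2 * (r / Real.pi) := by
  have h : ∀ x, ‖u x * ind r x‖ ^ 2 ≤ (Metric.closedBall (0 : Circle2Pi) r).indicator
      (fun _ => c ^ 2) x := by
    intro x
    rcases le_or_gt ‖x‖ r with h | h
    · rw [ind_of_le h, Set.indicator_of_mem (by simpa using h), mul_one]
      exact pow_le_pow_left₀ (norm_nonneg _) (hu x h) 2
    · rw [ind_of_gt h, Set.indicator_of_notMem (by simpa using h)]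
      simp
  have hi : Integrable ((Metric.closedBall (0 : Circle2Pi) r).indicator (fun _ => c ^ 2)) hm :=
    (integrable_const _).indicator Metric.isClosed_closedBall.measurableSet
  have h2 := integral_mono (((hum.mul (nice_ind r)).memLp 2).integrable_norm_pow (by norm_num)) hi h
  refine h2.trans (le_of_eq ?_)
  rw [integral_indicator_const _ Metric.isClosed_closedBall.measurableSet, meas_ball h0 h1,
    smul_eq_mul, mul_comm]

lemma int_norm_ind' {r : ℝ} (h0 : 0 ≤ r) (h1 : r ≤ Real.pi) :
    ∫ x, ‖ind r x‖ ^ 2 ∂hm ≤ (r / Real.pi) := by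
  have := int_norm_ind h0 h1 (u := fun _ => 1) (c := 1) (by simp) (nice_of_cont continuous_const)
  simpa using this

/-- unnormalized bump -/
lemma conv_E1 (u v : Circle2Pi → ℂ) (hu : Nice u) (hv : Nice v) (x : Circle2Pi) :
    E1 x * circleConv u v x = circleConv (fun y => E1 y * u y) (fun y => fourier 1 y * v y) x
      + circleConv u (fun y => E1 y * v y) x := by
  unfold circleConv
  rw [← integral_const_mul, ← integral_add]
  · congr 1
    ext y
    unfold E1
    rw [← fourier_mul_sub 1 x y]
    ring
  · exact ((((nice_of_cont E1_cont).mul hu).comp_sub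
      ((nice_of_cont (fourier 1).continuous).mul hv)) x).integrable
  · exact (hu.comp_sub ((nice_of_cont E1_cont).mul hv) x).integrable

lemma conv_support {r s : ℝ} {x : Circle2Pi} (h : circleConv (ind r) (ind s) x ≠ 0) :
    ‖x‖ ≤ r + s := by
  by_contra hx
  push Not at hx
  apply h
  unfold circleConv
  rw [← integral_zero Circle2Pi ℂ]
  congr 1
  ext y
  rcases le_or_gt ‖y‖ r with h1 | h1
  · rcases le_or_gt ‖x - y‖ s with h2 | h2
    · have := norm_add_le y (x - y)
      rw [add_sub_cancel] at this
      linarith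
    · rw [ind_of_gt h2, mul_zero]
  · rw [ind_of_gt h1, zero_mul]

lemma conv_const {r s : ℝ} (h0 : 0 ≤ s) (h1 : s ≤ Real.pi) {x : Circle2Pi} (h : ‖x‖ ≤ r - s) :
    circleConv (ind r) (ind s) x = ((s / Real.pi : ℝ) : ℂ) := by
  rw [← int_ind h0 h1, ← integral_sub_left_eq_self (ind s) hm x]
  unfold circleConv
  congr 1
  ext y
  rcases le_or_gt ‖x - y‖ s with h2 | h2
  · have := norm_sub_le x (x - y)
    rw [sub_sub_cancel] at this
    rw [ind_of_le (show ‖y‖ ≤ r by linarith), one_mul]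
  · rw [ind_of_gt h2, mul_zero]

lemma conv_neg (r s : ℝ) (x : Circle2Pi) :
    circleConv (ind r) (ind s) (-x) = circleConv (ind r) (ind s) x := by
  unfold circleConv
  rw [← integral_neg_eq_self (fun y => ind r y * ind s (-x - y)) hm]
  congr 1
  ext y
  rw [ind_neg, ← ind_neg s]
  congr 2
  abel

lemma conv_ind_norm (r s : ℝ) (x : Circle2Pi) :
    ((‖circleConv (ind r) (ind s) x‖ : ℝ) : ℂ) = circleConv (ind r) (ind s) x := by
  have h : circleConv (ind r) (ind s) x =
      ((∫ y, (‖ind r y * ind s (x - y)‖ : ℝ) ∂hm : ℝ) : ℂ) := by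
    rw [← integral_complex_ofReal]
    unfold circleConv
    congr 1
    ext y
    rcases le_or_gt ‖y‖ r with h1 | h1
    · rcases le_or_gt ‖x - y‖ s with h2 | h2
      · rw [ind_of_le h1, ind_of_le h2]; simp
      · rw [ind_of_gt h2]; simp
    · rw [ind_of_gt h1]; simp
  rw [h, Complex.norm_real, Real.norm_of_nonneg]
  exact integral_nonneg fun _ => norm_nonneg _

lemma conv_ind_cont (r s : ℝ) : Continuous (circleConv (ind r) (ind s)) :=
  conv_cont (nice_ind r) (nice_ind s) (ind_ae_cont s)

lemma AB_fourier (n : ℤ) : AB (fun x => fourier n x) 1 := by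
  have h : ∀ m, ‖fourierCoeff (fun x : Circle2Pi => (fourier n x : ℂ)) m‖ = Pi.single (M := fun _ => ℝ) n 1 m := by
    intro m
    have := congrFun (fourierCoeff_fourier (T := 2 * Real.pi) n) m
    rw [show fourierCoeff (fun x : Circle2Pi => (fourier n x : ℂ)) m = _ from this]
    by_cases hm : m = n
    · subst hm; simp
    · simp [hm]
  have hs : HasSum (Pi.single (M := fun _ => ℝ) n (1 : ℝ)) 1 := hasSum_pi_single n 1
  exact AB.of_le hs.summable hs.tsum_eq.le fun m => (h m).le

/-- bump -/
def phi (ρ : ℝ) : Circle2Pi → ℂ :=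
  fun x => (((Real.pi / ρ) ^ 2 : ℝ) : ℂ) * circleConv (ind ρ) (ind ρ) x

/-- trapezoid -/
def Vt (ρ : ℝ) : Circle2Pi → ℂ :=
  fun x => ((Real.pi / (3 * ρ) : ℝ) : ℂ) * circleConv (ind (6 * ρ)) (ind (3 * ρ)) x

lemma phi_cont (ρ : ℝ) : Continuous (phi ρ) := continuous_const.mul (conv_ind_cont _ _)

lemma Vt_cont (ρ : ℝ) : Continuous (Vt ρ) := continuous_const.mul (conv_ind_cont _ _)

lemma num1 {ρ : ℝ} (h0 : 0 < ρ) : |Real.pi / (3 * ρ)| * (√(6 * ρ / Real.pi) * √(3 * ρ / Real.pi)) = √2 := by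
  have hp := Real.pi_pos
  rw [abs_of_pos (by positivity), show 6 * ρ / Real.pi = 2 * (3 * ρ / Real.pi) by ring,
    Real.sqrt_mul (by norm_num), mul_assoc, Real.mul_self_sqrt (by positivity)]
  field_simp

lemma phi_AB {ρ : ℝ} (h0 : 0 < ρ) (h1 : 6 * ρ ≤ Real.pi) : AB (phi ρ) (Real.pi / ρ) := by
  have hp := Real.pi_pos
  have h := (AB.conv (nice_ind ρ) (nice_ind ρ) (int_norm_ind' h0.le (by linarith))
    (int_norm_ind' h0.le (by linarith))).smul (((Real.pi / ρ) ^ 2 : ℝ) : ℂ)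
  refine AB.mono h (le_of_eq ?_)
  rw [Complex.norm_real, Real.norm_of_nonneg (by positivity), Real.mul_self_sqrt (by positivity)]
  field_simp

lemma Vt_AB {ρ : ℝ} (h0 : 0 < ρ) (h1 : 6 * ρ ≤ Real.pi) : AB (Vt ρ) √2 := by
  have h := (AB.conv (nice_ind (6 * ρ)) (nice_ind (3 * ρ)) (int_norm_ind' (by linarith) (by linarith))
    (int_norm_ind' (by linarith) (by linarith))).smul ((Real.pi / (3 * ρ) : ℝ) : ℂ)
  refine AB.mono h (le_of_eq ?_)
  rw [Complex.norm_real, Real.norm_eq_abs, num1 h0]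

lemma nice_f (n : ℤ) : Nice (fun x => fourier n x) := nice_of_cont (fourier n).continuous

lemma eVt_AB {ρ : ℝ} (h0 : 0 < ρ) (h1 : 6 * ρ ≤ Real.pi) :
    AB (fun x => fourier 1 x * Vt ρ x) √2 := by
  have h := (AB.conv ((nice_f 1).mul (nice_ind (6 * ρ))) ((nice_f 1).mul (nice_ind (3 * ρ)))
    (int_norm_ind (c := 1) (by linarith) (by linarith) (fun x _ => (norm_fourier 1 x).le) (nice_f 1))
    (int_norm_ind (c := 1) (by linarith) (by linarith) (fun x _ => (norm_fourier 1 x).le)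
      (nice_f 1))).smul ((Real.pi / (3 * ρ) : ℝ) : ℂ)
  have h2 := AB.mono h (L := √2) (le_of_eq (by
    rw [Complex.norm_real, Real.norm_eq_abs, one_pow, one_mul, one_mul, num1 h0]))
  convert h2 using 2 with x
  rw [conv_mod]
  unfold Vt
  ring

lemma E1_nice : Nice E1 := nice_of_cont E1_cont

lemma EVt_AB {ρ : ℝ} (h0 : 0 < ρ) (h1 : 6 * ρ ≤ Real.pi) :
    AB (fun x => E1 x * Vt ρ x) (9 * ρ * √2) := by
  have n6 := nice_ind (6 * ρ)
  have n3 := nice_ind (3 * ρ)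
  have ha := AB.conv (E1_nice.mul n6) ((nice_f 1).mul n3)
    (int_norm_ind (c := 6 * ρ) (by linarith) (by linarith)
      (fun x hx => (E1_bound x).trans hx) E1_nice)
    (int_norm_ind (c := 1) (by linarith) (by linarith) (fun x _ => (norm_fourier 1 x).le) (nice_f 1))
  have hb := AB.conv n6 (E1_nice.mul n3) (int_norm_ind' (by linarith) (by linarith))
    (int_norm_ind (c := 3 * ρ) (by linarith) (by linarith)
      (fun x hx => (E1_bound x).trans hx) E1_nice)
  have c1 : Continuous (circleConv (fun y => E1 y * ind (6 * ρ) y) (fun y => fourier 1 y * ind (3 * ρ) y)) := by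
    refine conv_cont (E1_nice.mul n6) ((nice_f 1).mul n3) ?_
    filter_upwards [ind_ae_cont (3 * ρ)] with z hz
    exact (fourier 1).continuous.continuousAt.mul hz
  have c2 : Continuous (circleConv (ind (6 * ρ)) (fun y => E1 y * ind (3 * ρ) y)) := by
    refine conv_cont n6 (E1_nice.mul n3) ?_
    filter_upwards [ind_ae_cont (3 * ρ)] with z hz
    exact E1_cont.continuousAt.mul hz
  have h := (ha.add hb (nice_of_cont c1).integrable (nice_of_cont c2).integrable).smul
    ((Real.pi / (3 * ρ) : ℝ) : ℂ)
  have h2 := AB.mono h (L := 9 * ρ * √2) (le_of_eq (by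
    rw [Complex.norm_real, Real.norm_eq_abs, one_pow, one_mul, Real.sqrt_mul (by positivity),
      Real.sqrt_mul (by positivity), Real.sqrt_sq (by positivity), Real.sqrt_sq (by positivity),
      ← num1 h0]
    ring))
  convert h2 using 2 with x
  rw [← conv_E1 _ _ n6 n3]
  unfold Vt
  ring

lemma int_phi {ρ : ℝ} (h0 : 0 < ρ) (h1 : 6 * ρ ≤ Real.pi) : ∫ x, phi ρ x ∂hm = 1 := by
  have hp := Real.pi_pos
  unfold phi
  rw [integral_const_mul, integral_conv (nice_ind ρ) (nice_ind ρ), int_ind h0.le (by linarith),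
    ← Complex.ofReal_mul, ← Complex.ofReal_mul]
  norm_cast
  field_simp

lemma int_norm_phi {ρ : ℝ} (h0 : 0 < ρ) (h1 : 6 * ρ ≤ Real.pi) : ∫ x, ‖phi ρ x‖ ∂hm = 1 := by
  have h : ∀ x, ((‖phi ρ x‖ : ℝ) : ℂ) = phi ρ x := by
    intro x
    unfold phi
    rw [norm_mul, Complex.ofReal_mul, conv_ind_norm, Complex.norm_real,
      Real.norm_of_nonneg (by positivity)]
  have h2 := int_phi h0 h1
  rw [← integral_congr_ae (Filter.Eventually.of_forall h), integral_complex_ofReal] at h2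
  exact_mod_cast h2

lemma phi_supp {ρ : ℝ} {x : Circle2Pi} (h : phi ρ x ≠ 0) : ‖x‖ ≤ 2 * ρ := by
  have := conv_support (right_ne_zero_of_mul h)
  linarith

lemma int_E_phi {ρ : ℝ} (h0 : 0 < ρ) (h1 : 6 * ρ ≤ Real.pi) :
    ∫ x, ‖E1 x * phi ρ x‖ ∂hm ≤ 2 * ρ := by
  have np := nice_of_cont (phi_cont ρ)
  have h := integral_mono (μ := hm) (f := fun x => ‖E1 x * phi ρ x‖)
    (g := fun x => 2 * ρ * ‖phi ρ x‖) (E1_nice.mul np).integrable.norm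
    (np.integrable.norm.const_mul _) (by
      intro x
      simp only [norm_mul]
      by_cases hx : phi ρ x = 0
      · simp [hx]
      · exact mul_le_mul_of_nonneg_right ((E1_bound x).trans (phi_supp hx)) (norm_nonneg _))
  rw [integral_const_mul, int_norm_phi h0 h1, mul_one] at h
  exact h

lemma Vt_one {ρ : ℝ} (h0 : 0 < ρ) (h1 : 6 * ρ ≤ Real.pi) {x : Circle2Pi} (hx : ‖x‖ ≤ 3 * ρ) :
    Vt ρ x = 1 := by
  have hp := Real.pi_pos
  unfold Vt
  rw [conv_const (by linarith) (by linarith) (by linarith), ← Complex.ofReal_mul]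
  norm_cast
  field_simp

lemma Vt_neg (ρ : ℝ) (x : Circle2Pi) : Vt ρ (-x) = Vt ρ x := by
  unfold Vt
  rw [conv_neg]

lemma w_AB {ρ : ℝ} (h0 : 0 < ρ) (h1 : 6 * ρ ≤ Real.pi) :
    AB (fun x => E1 x * circleConv (phi ρ) (Vt ρ) x) (11 * √2 * ρ) := by
  have np := nice_of_cont (phi_cont ρ)
  have nV := nice_of_cont (Vt_cont ρ)
  have c1 := (fourier 1).continuous.mul (Vt_cont ρ)
  have c2 := E1_cont.mul (Vt_cont ρ)
  have ha := (eVt_AB h0 h1).conv_left (E1_nice.mul np) ((nice_f 1).mul nV) (by linarith)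
    (int_E_phi h0 h1)
  have hb := (EVt_AB h0 h1).conv_left np (E1_nice.mul nV) zero_le_one (int_norm_phi h0 h1).le
  have h := ha.add hb
    (nice_of_cont (conv_cont (E1_nice.mul np) ((nice_f 1).mul nV)
      (Filter.Eventually.of_forall fun z => c1.continuousAt))).integrable
    (nice_of_cont (conv_cont np (E1_nice.mul nV)
      (Filter.Eventually.of_forall fun z => c2.continuousAt))).integrable
  have h2 := h.mono (L := 11 * √2 * ρ) (le_of_eq (by ring))
  convert h2 using 2 with x
  rw [← conv_E1 _ _ np nV]

lemma AB.congr {u v : Circle2Pi → ℂ} {K : ℝ} (h : AB u K) (e : ∀ x, v x = u x) : AB v K := by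
  rwa [funext e]

lemma AB.modl {u : Circle2Pi → ℂ} {K : ℝ} (h : AB u K) (k : ℤ) :
    AB (fun x => fourier k x * u x) K := by
  have e : ∀ n, fourierCoeff (fun x => fourier k x * u x) n = fourierCoeff u (n - k) := by
    intro n
    unfold fourierCoeff
    congr 1
    ext x
    rw [smul_eq_mul, smul_eq_mul, ← mul_assoc, ← fourier_add]
    congr 2
    ring_nf
  have hs := h.1.comp_injective (Equiv.subRight k).injective
  refine AB.of_le hs ?_ fun n => ?_
  · exact ((Equiv.subRight k).tsum_eq (fun n => ‖fourierCoeff u n‖)).le.trans h.2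
  · rw [e]; rfl

lemma psi_AB {ρ : ℝ} (h0 : 0 < ρ) (h1 : 6 * ρ ≤ Real.pi) :
    AB (fun x => 1 - Vt ρ x) (1 + √2) := by
  have h := (AB_fourier 0).add ((Vt_AB h0 h1).smul (-1)) (nice_f 0).integrable
    (nice_of_cont (continuous_const.mul (Vt_cont ρ))).integrable
  have h2 := h.mono (L := 1 + √2) (by simp)
  refine h2.congr fun x => ?_
  rw [fourier_zero]
  ring

lemma main_est {X : Type*} [NormedAddCommGroup X] [NormedSpace ℂ X]
    (F : (Circle2Pi → ℂ) →ₗ[ℂ] X)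
    (hF : ∀ f : Circle2Pi → ℂ, MemFourierAlg f → ‖F f‖ ≤ fourierAlgNorm f)
    (α : ℝ) (hα0 : 0 ≤ α)
    (hdisj : ∀ φ ψ : Circle2Pi → ℂ, MemFourierAlg φ → MemFourierAlg ψ →
      tsupport φ ∩ tsupport ψ = ∅ →
      ‖F (circleConv φ (fun x => ψ (-x)))‖ ≤ α * fourierAlgNorm φ * fourierAlgNorm ψ)
    {ρ : ℝ} (h0 : 0 < ρ) (h1 : 6 * ρ ≤ Real.pi) :
    ‖F E1‖ ≤ 2 * (α * (Real.pi / ρ) * (1 + √2)) + 11 * √2 * ρ := by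
  have hp := Real.pi_pos
  have np := nice_of_cont (phi_cont ρ)
  have nV := nice_of_cont (Vt_cont ρ)
  have hconv : ∀ x, circleConv (phi ρ) (fun x => 1 - Vt ρ x) x = 1 - circleConv (phi ρ) (Vt ρ) x := by
    intro x
    have : circleConv (phi ρ) (fun x => 1 - Vt ρ x) x
        = ∫ y, phi ρ y - phi ρ y * Vt ρ (x - y) ∂hm := by
      unfold circleConv
      congr 1
      ext y
      ring
    rw [this, integral_sub np.integrable (np.comp_sub nV x).integrable, int_phi h0 h1]
    rfl
  have key : ∀ k : ℤ, ‖F (fun x => fourier k x * circleConv (phi ρ) (fun x => 1 - Vt ρ x) x)‖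
      ≤ α * (Real.pi / ρ) * (1 + √2) := by
    intro k
    have a1 := (phi_AB h0 h1).modl k
    have a2 := (psi_AB h0 h1).modl (-k)
    have h := hdisj (fun x => fourier k x * phi ρ x) (fun x => fourier (-k) x * (1 - Vt ρ x))
      ⟨(fourier k).continuous.mul (phi_cont ρ), a1.1⟩
      ⟨(fourier (-k)).continuous.mul (continuous_const.sub (Vt_cont ρ)), a2.1⟩ (by
        have s1 : tsupport (fun x => fourier k x * phi ρ x) ⊆ Metric.closedBall 0 (2 * ρ) := by
          refine closure_minimal (fun x hx => ?_) Metric.isClosed_closedBall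
          have := phi_supp (right_ne_zero_of_mul hx)
          simpa using this
        have s2 : tsupport (fun x => fourier (-k) x * (1 - Vt ρ x)) ⊆ (Metric.ball 0 (3 * ρ))ᶜ := by
          refine closure_minimal (fun x hx => ?_) Metric.isOpen_ball.isClosed_compl
          have hx2 := right_ne_zero_of_mul hx
          intro hb
          apply hx2
          rw [Vt_one h0 h1 (by simpa using (Metric.mem_ball.1 hb).le), sub_self]
        rw [Set.eq_empty_iff_forall_notMem]
        rintro x ⟨hx1, hx2⟩
        have t1 := s1 hx1
        have t2 := s2 hx2
        simp at t1 t2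
        linarith)
    have e : circleConv (fun x => fourier k x * phi ρ x)
        (fun x => (fun x => fourier (-k) x * (1 - Vt ρ x)) (-x)) =
        fun x => fourier k x * circleConv (phi ρ) (fun x => 1 - Vt ρ x) x := by
      ext x
      rw [← conv_mod]
      congr 1
      ext y
      show (fourier (-k) (-y) : ℂ) * (1 - Vt ρ (-y)) = fourier k y * (1 - Vt ρ y)
      rw [Vt_neg, fourier_apply, fourier_apply, neg_smul, smul_neg, neg_neg]
    rw [e] at h
    refine h.trans ?_
    have n2 : 0 ≤ fourierAlgNorm (fun x => fourier (-k) x * (1 - Vt ρ x)) :=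
      tsum_nonneg fun _ => norm_nonneg _
    exact mul_le_mul (mul_le_mul_of_nonneg_left a1.2 hα0) a2.2 n2 (by positivity)
  have w := w_AB h0 h1
  have cw : Continuous (circleConv (phi ρ) (Vt ρ)) :=
    conv_cont np nV (Filter.Eventually.of_forall fun z => (Vt_cont ρ).continuousAt)
  have hw := (hF _ ⟨E1_cont.mul cw, w.1⟩).trans w.2
  have dec : E1 = (fun x => fourier 1 x * circleConv (phi ρ) (fun x => 1 - Vt ρ x) x)
      - (fun x => fourier 0 x * circleConv (phi ρ) (fun x => 1 - Vt ρ x) x)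
      + fun x => E1 x * circleConv (phi ρ) (Vt ρ) x := by
    ext x
    simp only [Pi.add_apply, Pi.sub_apply]
    rw [hconv, fourier_zero]
    unfold E1
    ring
  rw [dec, map_add, map_sub]
  have b1 := key 1
  have b0 := key 0
  refine (norm_add_le _ _).trans ?_
  refine add_le_add ?_ hw
  refine (norm_sub_le _ _).trans ?_
  linarith

lemma E1_AB : AB E1 2 := by
  have h := (AB_fourier 1).add ((AB_fourier 0).smul (-1)) (nice_f 1).integrable
    (nice_of_cont (continuous_const.mul (fourier 0).continuous)).integrable
  have h2 := h.mono (L := 2) (by norm_num)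
  refine h2.congr fun x => ?_
  rw [fourier_zero]
  unfold E1
  ring

theorem stmt_0 (X : Type*) [NormedAddCommGroup X] [NormedSpace ℂ X] [CompleteSpace X]
    (F : (Circle2Pi → ℂ) →ₗ[ℂ] X)
    (hF : ∀ f : Circle2Pi → ℂ, MemFourierAlg f → ‖F f‖ ≤ fourierAlgNorm f)
    (α : ℝ) (hα0 : 0 ≤ α) (hα1 : α ≤ 1)
    (hdisj : ∀ φ ψ : Circle2Pi → ℂ, MemFourierAlg φ → MemFourierAlg ψ →
      tsupport φ ∩ tsupport ψ = ∅ →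
      ‖F (circleConv φ (fun x => ψ (-x)))‖ ≤ α * fourierAlgNorm φ * fourierAlgNorm ψ)
    (f : Circle2Pi → ℂ) (hf : ∀ s : Circle2Pi, f s = fourier 1 s - 1) :
    ‖F f‖ ≤ 12 * Real.sqrt (Real.pi * (1 + Real.sqrt 2)) * Real.sqrt α := by
  have hp := Real.pi_gt_three
  obtain rfl : f = E1 := funext hf
  have main := fun ρ (h0 : 0 < ρ) (h1 : 6 * ρ ≤ Real.pi) => main_est F hF α hα0 hdisj h0 h1
  have h2 : ‖F E1‖ ≤ 2 := (hF _ ⟨E1_cont, E1_AB.1⟩).trans E1_AB.2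
  have hs2 : √2 ≤ 3 / 2 := by
    rw [Real.sqrt_le_left (by norm_num)]; norm_num
  rcases hα0.eq_or_lt with rfl | hα
  · rw [Real.sqrt_zero, mul_zero]
    refine le_of_forall_pos_le_add fun ε hε => ?_
    have hm1 : 0 < min (ε / 22) (1 / 6) := by positivity
    have l1 := min_le_left (ε / 22) (1 / 6 : ℝ)
    have l2 := min_le_right (ε / 22) (1 / 6 : ℝ)
    have h := main (min (ε / 22) (1 / 6)) hm1 (by linarith)
    have := mul_le_mul_of_nonneg_right hs2 hm1.le
    rw [zero_mul, zero_mul, mul_zero, zero_add, mul_assoc] at h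
    linarith
  · rw [mul_assoc, ← Real.sqrt_mul (by positivity)]
    set q := √(Real.pi * (1 + √2) * α) with hq
    have hq0 : 0 < q := Real.sqrt_pos.2 (by positivity)
    have hqq : q * q = Real.pi * (1 + √2) * α := Real.mul_self_sqrt (by positivity)
    rcases le_or_gt (2 * q) Real.pi with hc | hc
    · have h := main (q / 3) (by positivity) (by linarith)
      have e : 2 * (α * (Real.pi / (q / 3)) * (1 + √2)) = 6 * q := by
        field_simp
        linarith
      rw [e] at h
      have := mul_le_mul_of_nonneg_right hs2 hq0.le
      nlinarith
    · linarith
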